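/- The quadratic fermionic operators on the gl(1|1) spin chain generate an sl(2) Lie algebra: setting 2h := Σ_{j=1}^N (−1)^j f_j† f_j − L·Id, one has [F†_(2), F_(2)] = 2h, [2h, F†_(2)] = 2 F†_(2), and [2h, F_(2)] = −2 F_(2). -/

import Mathlib

open Complex Matrix

noncomputable section

namespace SpinChain

/-- The state space of the `N`-site spin chain, `(ℂ²)^{⊗N}` realised as functions on
spin configurations. -/
abbrev V (N : ℕ) := (Fin N → Fin 2) → ℂ

/-- Operators on the spin chain, realised as matrices. -/
abbrev Op (N : ℕ) := Matrix (Fin N → Fin 2) (Fin N → Fin 2) ℂ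

def sigmaX : Matrix (Fin 2) (Fin 2) ℂ := !![0, 1; 1, 0]
def sigmaY : Matrix (Fin 2) (Fin 2) ℂ := !![0, -I; I, 0]
def sigmaZ : Matrix (Fin 2) (Fin 2) ℂ := !![1, 0; 0, -1]
def sigmaPlus : Matrix (Fin 2) (Fin 2) ℂ := ((1 : ℂ)/2) • (sigmaX + I • sigmaY)
def sigmaMinus : Matrix (Fin 2) (Fin 2) ℂ := ((1 : ℂ)/2) • (sigmaX - I • sigmaY)

variable (N : ℕ)

/-- The operator acting as the 2×2 matrix `a` on the `j`-th tensor factor and as the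
identity on the others. -/
def site (a : Matrix (Fin 2) (Fin 2) ℂ) (j : Fin N) : Op N :=
  Matrix.of fun x y =>
    a (x j) (y j) * ∏ k ∈ Finset.univ.filter (fun k => k ≠ j), (if x k = y k then (1 : ℂ) else 0)

/-- Jordan–Wigner string `∏_{k<j} diag(z 0, z 1)_k`. -/
def string (z : Fin 2 → ℂ) (j : Fin N) : Op N :=
  (((List.finRange N).filter (fun k => decide (k < j))).map
    (fun k => site N (Matrix.diagonal z) k)).prod

/-- Jordan–Wigner fermion `c_j := i^{1−j}·(∏_{k<j} diag(−i,i)_k)·σ⁻_j`; here the index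
`j : Fin N` labels the physical site `j+1`. -/
def c (j : Fin N) : Op N :=
  (I ^ (-(j : ℤ))) • (string N ![-I, I] j * site N sigmaMinus j)

/-- Jordan–Wigner fermion `c_j† := i^{j−1}·(∏_{k<j} diag(i,−i)_k)·σ⁺_j`. -/
def cd (j : Fin N) : Op N :=
  (I ^ ((j : ℕ))) • (string N ![I, -I] j * site N sigmaPlus j)

/-- The `gl(1|1)` fermion `f_j := i^j c_j` (physical index `j = j.val + 1`). -/
def f (j : Fin N) : Op N := (I ^ ((j : ℕ) + 1)) • c N j

/-- The `gl(1|1)` fermion `f_j† := i^j c_j†`. -/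
def fd (j : Fin N) : Op N := (I ^ ((j : ℕ) + 1)) • cd N j

/-- Cyclic successor on site indices. -/
def fsucc {N : ℕ} (j : Fin N) : Fin N := ⟨(j.val + 1) % N, Nat.mod_lt _ j.pos⟩

/-- Periodic Temperley–Lieb generators
`e_j = (f_j+f_{j+1})(f_j†+f_{j+1}†)`, with `e_N = (f_N+f_1)(f_N†+f_1†)`. -/
def e (j : Fin N) : Op N := (f N j + f N (fsucc j)) * (fd N j + fd N (fsucc j))

/-- `F_(m) := Σ_{j_1<⋯<j_m} f_{j_1}⋯f_{j_m}`. -/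
def Fg (m : ℕ) : Op N :=
  ∑ s ∈ Finset.univ.powersetCard m, ((s.sort (· ≤ ·)).map (f N)).prod

/-- `F†_(m) := Σ_{j_1<⋯<j_m} f†_{j_1}⋯f†_{j_m}`. -/
def Fdg (m : ℕ) : Op N :=
  ∑ s ∈ Finset.univ.powersetCard m, ((s.sort (· ≤ ·)).map (fd N)).prod

/-- `S^z := (1/2) Σ_j σ^z_j`. -/
def Sz : Op N := ((1 : ℂ)/2) • ∑ j : Fin N, site N sigmaZ j

theorem sum_range_alternating (n : ℕ) :
    ∑ c ∈ Finset.range (2 * n), ((-1 : ℤ) ^ (c + 1)) = 0 := by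
  induction n with
  | zero => simp
  | succ n ih =>
    rw [show 2 * (n + 1) = 2 * n + 1 + 1 by ring, Finset.sum_range_succ, Finset.sum_range_succ, ih]
    simp [pow_succ]

/-- The sign of `a - c`. -/
def orderSign (c a : ℕ) : ℤ := if c < a then 1 else if a < c then -1 else 0

theorem sum_range_alternating_mul_orderSign (n a d : ℕ) :
    ∑ c ∈ Finset.range (2 * n), (-1 : ℤ) ^ (c + 1) * (orderSign c a * orderSign c d)
      = if a < 2 * n then (if d < 2 * n then (if a = d then -(-1 : ℤ) ^ (d + 1) else 0) else -1)
        else if d < 2 * n then -1 else 0 := by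
  induction n with
  | zero => simp
  | succ n ih =>
    have h1 : (-1 : ℤ) ^ (2 * n + 1) = -1 := by simp [pow_succ]
    have h2 : (-1 : ℤ) ^ (2 * n + 1 + 1) = 1 := by simp [pow_succ]
    rw [show 2 * (n + 1) = 2 * n + 1 + 1 by ring, Finset.sum_range_succ, Finset.sum_range_succ, ih,
      h1, h2]
    have hd1 : d = 2 * n → (-1 : ℤ) ^ (d + 1) = -1 := by rintro rfl; exact h1
    have hd2 : d = 2 * n + 1 → (-1 : ℤ) ^ (d + 1) = 1 := by rintro rfl; exact h2
    generalize (-1 : ℤ) ^ (d + 1) = e at *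
    unfold orderSign
    grind

theorem sum_range_lt_alternating (n : ℕ) :
    ∑ d ∈ Finset.range (2 * n), ∑ c ∈ Finset.range d, (-1 : ℤ) ^ (c + 1) * (-1) ^ (d + 1) = -n := by
  induction n with
  | zero => simp
  | succ n ih =>
    have h1 : (-1 : ℤ) ^ (2 * n + 1) = -1 := by simp [pow_succ]
    have h2 : (-1 : ℤ) ^ (2 * n + 1 + 1) = 1 := by simp [pow_succ]
    rw [show 2 * (n + 1) = 2 * n + 1 + 1 by ring, Finset.sum_range_succ, Finset.sum_range_succ, ih,
      Finset.sum_range_succ, ← Finset.sum_mul, ← Finset.sum_mul, sum_range_alternating n, h1, h2]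
    push_cast; ring

section AnticommutationRelations

variable {N} {A : Type*} [Ring A]

/-- The sum of `g i * g j` over all pairs `i < j`. -/
def pairSum (g : Fin N → A) : A := ∑ i, ∑ j, if i < j then g i * g j else 0

theorem ring_lie_sum (x : A) (g : Fin N → A) : ⁅x, ∑ i, g i⁆ = ∑ i, ⁅x, g i⁆ := by
  simp only [Ring.lie_def, Finset.mul_sum, Finset.sum_mul, Finset.sum_sub_distrib]

theorem ring_sum_lie (g : Fin N → A) (x : A) : ⁅∑ i, g i, x⁆ = ∑ i, ⁅g i, x⁆ := by
  simp only [Ring.lie_def, Finset.mul_sum, Finset.sum_mul, Finset.sum_sub_distrib]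

theorem ring_zsmul_lie (r : ℤ) (x y : A) : ⁅r • x, y⁆ = r • ⁅x, y⁆ := by
  simp only [Ring.lie_def, smul_mul_assoc, mul_smul_comm, smul_sub]

theorem ring_lie_mul (x a b : A) : ⁅x, a * b⁆ = ⁅x, a⁆ * b + a * ⁅x, b⁆ := by
  simp only [Ring.lie_def]; noncomm_ring

theorem lie_pairSum (x : A) (g : Fin N → A) :
    ⁅x, pairSum g⁆ = ∑ i, ∑ j, if i < j then ⁅x, g i⁆ * g j + g i * ⁅x, g j⁆ else 0 := by
  simp only [pairSum, ring_lie_sum]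
  refine Finset.sum_congr rfl fun i _ => Finset.sum_congr rfl fun j _ => ?_
  split_ifs
  · rw [ring_lie_mul]
  · simp [Ring.lie_def]

theorem lie_pairSum_of_lie_eq_smul {x : A} {g : Fin N → A} (r : ℤ) (h : ∀ i, ⁅x, g i⁆ = r • g i) :
    ⁅x, pairSum g⁆ = (2 * r) • pairSum g := by
  rw [lie_pairSum, pairSum, Finset.smul_sum]
  refine Finset.sum_congr rfl fun i _ => ?_
  rw [Finset.smul_sum]
  refine Finset.sum_congr rfl fun j _ => ?_
  split_ifs
  · rw [h, h, smul_mul_assoc, mul_smul_comm, ← add_smul, two_mul]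
  · simp

variable {f fd : Fin N → A}

/-- The number operator `∑ j, (-1) ^ (j + 1) • fd j * f j`. -/
def alternatingNumber (f fd : Fin N → A) : A := ∑ j : Fin N, (-1 : ℤ) ^ ((j : ℕ) + 1) • (fd j * f j)

theorem sign_smul_sign_smul (n : ℕ) (a : A) : (-1 : ℤ) ^ n • (-1 : ℤ) ^ n • a = a := by
  rw [smul_smul, ← mul_pow]; simp

theorem lie_alternatingNumber_creation (hdd : ∀ j k, fd j * fd k + fd k * fd j = 0)
    (hfd : ∀ j k, f j * fd k + fd k * f j = if j = k then (-1 : ℤ) ^ ((j : ℕ) + 1) • 1 else 0)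
    (a : Fin N) :
    ⁅alternatingNumber f fd, fd a⁆ = fd a := by
  have key (j : Fin N) : ⁅fd j * f j, fd a⁆
      = fd j * (f j * fd a + fd a * f j) - (fd j * fd a + fd a * fd j) * f j := by
    rw [Ring.lie_def]; noncomm_ring
  simp only [alternatingNumber, ring_sum_lie, ring_zsmul_lie, key, hdd, hfd]
  simp [sign_smul_sign_smul, -zsmul_eq_mul, -zsmul_one]

theorem lie_alternatingNumber_annihilation (hff : ∀ j k, f j * f k + f k * f j = 0)
    (hfd : ∀ j k, f j * fd k + fd k * f j = if j = k then (-1 : ℤ) ^ ((j : ℕ) + 1) • 1 else 0)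
    (a : Fin N) :
    ⁅alternatingNumber f fd, f a⁆ = - f a := by
  have key (j : Fin N) : ⁅fd j * f j, f a⁆
      = fd j * (f j * f a + f a * f j) - (f a * fd j + fd j * f a) * f j := by
    rw [Ring.lie_def]; noncomm_ring
  simp only [alternatingNumber, ring_sum_lie, ring_zsmul_lie, key, hff, hfd]
  simp [sign_smul_sign_smul, -zsmul_eq_mul, -zsmul_one]

theorem lie_pairSum_annihilation
    (hfd : ∀ j k, f j * fd k + fd k * f j = if j = k then (-1 : ℤ) ^ ((j : ℕ) + 1) • 1 else 0)
    (c : Fin N) :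
    ⁅pairSum fd, f c⁆ = (-1 : ℤ) ^ ((c : ℕ) + 1) • -∑ a : Fin N, orderSign c a • fd a := by
  have key (a b : Fin N) : ⁅if a < b then fd a * fd b else 0, f c⁆
      = (if c = b then (if a < c then (-1 : ℤ) ^ ((c : ℕ) + 1) • fd a else 0) else 0)
        - if c = a then (if c < b then (-1 : ℤ) ^ ((c : ℕ) + 1) • fd b else 0) else 0 := by
    have : ⁅fd a * fd b, f c⁆
      = fd a * (f c * fd b + fd b * f c) - (f c * fd a + fd a * f c) * fd b := by
      rw [Ring.lie_def]; noncomm_ring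
    by_cases hab : a < b
    · rw [if_pos hab, this, hfd, hfd]
      rcases eq_or_ne c b with rfl | hcb
      · simp [hab, hab.ne', -zsmul_eq_mul, -zsmul_one]
      rcases eq_or_ne c a with rfl | hca
      · simp [hab, hcb, -zsmul_eq_mul, -zsmul_one]
      · simp [hcb, hca]
    · rw [if_neg hab]
      rcases eq_or_ne c b with rfl | hcb
      · simp [Ring.lie_def, hab]
      rcases eq_or_ne c a with rfl | hca
      · simp [Ring.lie_def, hab]
      · simp [Ring.lie_def, hcb, hca]
  simp only [pairSum, ring_sum_lie, key, Finset.sum_sub_distrib]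
  rw [Finset.sum_comm (f := fun a b =>
    if c = a then (if c < b then (-1 : ℤ) ^ ((c : ℕ) + 1) • fd b else 0) else 0)]
  simp only [Finset.sum_ite_eq, Finset.mem_univ, if_true]
  rw [← Finset.sum_sub_distrib, ← Finset.sum_neg_distrib, Finset.smul_sum]
  refine Finset.sum_congr rfl fun a _ => ?_
  rcases lt_trichotomy a c with h | h | h
  · simp [orderSign, h, h.not_gt]
  · simp [orderSign, h]
  · simp [orderSign, h, h.not_gt]

theorem lie_pairSum_pairSum {L : ℕ} {f fd : Fin (2 * L) → A}
    (hfd : ∀ j k, f j * fd k + fd k * f j = if j = k then (-1 : ℤ) ^ ((j : ℕ) + 1) • 1 else 0) :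
    ⁅pairSum fd, pairSum f⁆ = alternatingNumber f fd - (L : A) := by
  set G : Fin (2 * L) → A := fun c => -∑ a : Fin (2 * L), orderSign c a • fd a with hG
  have hGf (c d : Fin (2 * L)) (h : c < d) :
      f c * G d = -(G d * f c) + (-1 : ℤ) ^ ((c : ℕ) + 1) • 1 := by
    have : f c * G d + G d * f c = -∑ a : Fin (2 * L), orderSign d a • (f c * fd a + fd a * f c) := by
      simp only [hG, mul_neg, neg_mul, Finset.mul_sum, Finset.sum_mul, smul_add,
        Finset.sum_add_distrib, mul_smul_comm, smul_mul_assoc]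
      abel
    rw [← sub_eq_iff_eq_add', sub_neg_eq_add, this]
    simp [hfd, orderSign, h, h.not_gt]
  have hcd (c d : Fin (2 * L)) :
      (if c < d then ⁅pairSum fd, f c⁆ * f d + f c * ⁅pairSum fd, f d⁆ else 0)
      = (if c < d then (-1 : ℤ) ^ ((c : ℕ) + 1) • (G c * f d) else 0)
        - (if c < d then (-1 : ℤ) ^ ((d : ℕ) + 1) • (G d * f c) else 0)
        + (if c < d then (-1 : ℤ) ^ ((c : ℕ) + 1) * (-1 : ℤ) ^ ((d : ℕ) + 1) else 0) • 1 := by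
    split_ifs with h
    · rw [lie_pairSum_annihilation hfd, lie_pairSum_annihilation hfd]
      change (_ • G c) * f d + f c * (_ • G d) = _
      rw [mul_smul_comm, hGf c d h, smul_mul_assoc, smul_add, smul_smul,
        mul_comm ((-1 : ℤ) ^ _), smul_neg]
      abel
    · simp
  have hconst : ∑ c : Fin (2 * L), ∑ d : Fin (2 * L),
      (if c < d then (-1 : ℤ) ^ ((c : ℕ) + 1) * (-1 : ℤ) ^ ((d : ℕ) + 1) else 0) = -L := by
    rw [Finset.sum_comm, ← sum_range_lt_alternating, ← Fin.sum_univ_eq_sum_range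
      (fun d => ∑ c ∈ Finset.range d, (-1 : ℤ) ^ (c + 1) * (-1) ^ (d + 1))]
    refine Finset.sum_congr rfl fun d _ => ?_
    simp only [Fin.lt_def]
    rw [Fin.sum_univ_eq_sum_range
      (fun c => if c < (d : ℕ) then (-1 : ℤ) ^ (c + 1) * (-1) ^ ((d : ℕ) + 1) else 0),
      ← Finset.sum_filter]
    congr 1
    ext c
    simp only [Finset.mem_filter, Finset.mem_range]
    omega
  have hcoef (d : Fin (2 * L)) :
      ∑ c : Fin (2 * L), (orderSign c d * (-1 : ℤ) ^ ((c : ℕ) + 1)) • G c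
        = (-1 : ℤ) ^ ((d : ℕ) + 1) • fd d := by
    simp only [hG, Finset.smul_sum, smul_neg, smul_smul, Finset.sum_neg_distrib]
    rw [Finset.sum_comm]
    simp only [← Finset.sum_smul]
    have (a : Fin (2 * L)) : ∑ c : Fin (2 * L),
        orderSign c d * (-1 : ℤ) ^ ((c : ℕ) + 1) * orderSign c a
        = if a = d then -(-1 : ℤ) ^ ((d : ℕ) + 1) else 0 := by
      have := sum_range_alternating_mul_orderSign L a d
      rw [← Fin.sum_univ_eq_sum_range
        (fun c => (-1 : ℤ) ^ (c + 1) * (orderSign c a * orderSign c d))] at this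
      simp only [a.2, d.2, if_true, Fin.val_inj] at this
      rw [← this]
      exact Finset.sum_congr rfl fun c _ => by ring
    simp [this]
  rw [lie_pairSum]
  simp only [hcd, Finset.sum_add_distrib, Finset.sum_sub_distrib, ← Finset.sum_smul, hconst]
  rw [Finset.sum_comm, ← Finset.sum_sub_distrib, sub_eq_add_neg (alternatingNumber f fd)]
  congr 1
  · refine Finset.sum_congr rfl fun d _ => ?_
    rw [← smul_mul_assoc, ← hcoef, Finset.sum_mul, ← Finset.sum_sub_distrib]
    refine Finset.sum_congr rfl fun c _ => ?_
    rcases lt_trichotomy c d with h | h | h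
    · simp [orderSign, h, h.not_gt, -zsmul_eq_mul, -zsmul_one]
    · simp [orderSign, h]
    · simp [orderSign, h, h.not_gt, -zsmul_eq_mul, -zsmul_one]
  · simp

theorem sum_powersetCard_two_sort (g : Fin N → A) :
    ∑ s ∈ (Finset.univ : Finset (Fin N)).powersetCard 2, ((s.sort (· ≤ ·)).map g).prod
      = pairSum g := by
  rw [pairSum, ← Finset.sum_product' (f := fun i j => if i < j then g i * g j else 0),
    ← Finset.sum_filter]
  symm
  refine Finset.sum_bij (fun p _ => {p.1, p.2}) ?_ ?_ ?_ ?_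
  · rintro ⟨i, j⟩ h
    simp only [Finset.mem_filter] at h
    simp [Finset.mem_powersetCard, Finset.card_pair h.2.ne]
  · rintro ⟨i, j⟩ h ⟨k, l⟩ h' e
    simp only [Finset.mem_filter, Finset.mem_product, Finset.mem_univ, true_and] at h h'
    have hi : i ∈ ({k, l} : Finset (Fin N)) := by rw [← e]; simp
    have hj : j ∈ ({k, l} : Finset (Fin N)) := by rw [← e]; simp
    simp only [Finset.mem_insert, Finset.mem_singleton] at hi hj
    ext <;> grind
  · intro s hs
    obtain ⟨x, y, hxy, rfl⟩ := Finset.card_eq_two.1 (Finset.mem_powersetCard.1 hs).2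
    rcases lt_or_gt_of_ne hxy with h | h
    · exact ⟨(x, y), by simpa using h, rfl⟩
    · exact ⟨(y, x), by simpa using h, Finset.pair_comm _ _⟩
  · rintro ⟨i, j⟩ h
    simp only [Finset.mem_filter] at h
    rw [Finset.sort_insert _ (by simpa using h.2.le) (by simpa using h.2.ne)]
    simp

end AnticommutationRelations

section JordanWigner

variable {N}

theorem site_apply (a : Matrix (Fin 2) (Fin 2) ℂ) (j : Fin N) (x y : Fin N → Fin 2) :
    site N a j x y = ∑ b, a (x j) b * if Function.update x j b = y then 1 else 0 := by
  have h (b : Fin 2) : Function.update x j b = y ↔ b = y j ∧ ∀ k ≠ j, x k = y k := by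
    rw [Function.update_eq_iff]
  simp only [site, Matrix.of_apply, h, Finset.prod_ite_zero, Finset.mem_filter, Finset.mem_univ,
    true_and, Finset.prod_const_one, ite_and, mul_ite, mul_one, mul_zero, Finset.sum_ite_eq',
    if_true]

theorem site_mul_apply (a : Matrix (Fin 2) (Fin 2) ℂ) (j : Fin N) (M : Op N)
    (x y : Fin N → Fin 2) :
    (site N a j * M) x y = ∑ b, a (x j) b * M (Function.update x j b) y := by
  simp only [Matrix.mul_apply, site_apply, Finset.sum_mul]
  rw [Finset.sum_comm]
  simp

theorem site_mul_site (a b : Matrix (Fin 2) (Fin 2) ℂ) (j : Fin N) :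
    site N a j * site N b j = site N (a * b) j := by
  ext x y
  rw [site_mul_apply]
  simp only [site_apply, Matrix.mul_apply, Finset.mul_sum, Finset.sum_mul]
  rw [Finset.sum_comm]
  simp only [Function.update_self, Function.update_idem, mul_assoc]

theorem site_mul_site_comm (a b : Matrix (Fin 2) (Fin 2) ℂ) {j k : Fin N} (h : j ≠ k) :
    site N a j * site N b k = site N b k * site N a j := by
  ext x y
  simp only [site_mul_apply, site_apply, Finset.mul_sum]
  rw [Finset.sum_comm]
  simp only [Function.update_of_ne h, Function.update_of_ne h.symm, Function.update_comm h,
    mul_left_comm]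

theorem site_add (a b : Matrix (Fin 2) (Fin 2) ℂ) (j : Fin N) :
    site N (a + b) j = site N a j + site N b j := by
  ext x y
  simp [site, add_mul]

theorem site_zero (j : Fin N) : site N 0 j = 0 := by
  ext x y
  simp [site]

theorem site_diagonal (z : Fin 2 → ℂ) (j : Fin N) :
    site N (Matrix.diagonal z) j = Matrix.diagonal fun x => z (x j) := by
  ext x y
  rw [site_apply, Finset.sum_eq_single (x j)]
  · simp [Matrix.diagonal_apply]
  · intro b _ hb
    simp [Matrix.diagonal_apply_ne _ hb.symm]
  · simp

theorem site_one (j : Fin N) : site N 1 j = 1 := by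
  rw [← Matrix.diagonal_one, site_diagonal, Matrix.diagonal_one]

theorem string_eq_diagonal (z : Fin 2 → ℂ) (j : Fin N) :
    string N z j = Matrix.diagonal fun x => ∏ k ∈ Finset.Iio j, z (x k) := by
  have h (l : List (Fin N)) : (l.map fun k => site N (Matrix.diagonal z) k).prod
      = Matrix.diagonal fun x => (l.map fun k => z (x k)).prod := by
    induction l with
    | nil => simp
    | cons k l ih => rw [List.map_cons, List.prod_cons, ih, site_diagonal,
        Matrix.diagonal_mul_diagonal]; rfl
  rw [string, h]
  congr 1
  ext x
  rw [← List.prod_toFinset _ ((List.nodup_finRange N).filter _)]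
  congr 1
  ext k
  simp

/-- The Jordan–Wigner string `∏_{k<j} σᶻ_k`. -/
def parityString (j : Fin N) : Op N := Matrix.diagonal fun x => ∏ k ∈ Finset.Iio j, ![1, -1] (x k)

theorem string_smul (u : ℂ) (j : Fin N) :
    string N ![u, -u] j = u ^ (j : ℕ) • parityString j := by
  rw [string_eq_diagonal, parityString, ← Matrix.diagonal_smul]
  congr 1
  ext x
  have (b : Fin 2) : (![u, -u] : Fin 2 → ℂ) b = u * ![1, -1] b := by fin_cases b <;> simp
  simp [this, Finset.prod_mul_distrib]

theorem parityString_mul_self (j : Fin N) : parityString j * parityString j = 1 := by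
  rw [parityString, Matrix.diagonal_mul_diagonal, ← Matrix.diagonal_one]
  congr 1
  ext x
  rw [← Finset.prod_mul_distrib]
  refine Finset.prod_eq_one fun k _ => ?_
  generalize x k = b
  fin_cases b <;> simp

theorem parityString_comm (j k : Fin N) :
    parityString j * parityString k = parityString k * parityString j := by
  simp only [parityString, Matrix.diagonal_mul_diagonal, mul_comm]

theorem site_mul_parityString_of_le (a : Matrix (Fin 2) (Fin 2) ℂ) {j k : Fin N} (h : k ≤ j) :
    site N a j * parityString k = parityString k * site N a j := by
  ext x y
  rw [parityString, Matrix.mul_diagonal, Matrix.diagonal_mul, mul_comm, site_apply, Finset.mul_sum,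
    Finset.mul_sum]
  refine Finset.sum_congr rfl fun b _ => ?_
  split_ifs with hy
  · subst hy
    congr 1
    refine Finset.prod_congr rfl fun i hi => ?_
    rw [Function.update_of_ne ((Finset.mem_Iio.1 hi).trans_le h).ne]
  · simp

theorem site_mul_parityString_of_lt {a : Matrix (Fin 2) (Fin 2) ℂ} (ha : ∀ b, a b b = 0)
    {j k : Fin N} (h : j < k) :
    site N a j * parityString k = -(parityString k * site N a j) := by
  ext x y
  rw [Matrix.neg_apply, parityString, Matrix.mul_diagonal, Matrix.diagonal_mul, mul_comm,
    site_apply, Finset.mul_sum, Finset.mul_sum, ← Finset.sum_neg_distrib]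
  refine Finset.sum_congr rfl fun b _ => ?_
  split_ifs with hy
  · subst hy
    rw [← Finset.mul_prod_erase _ _ (Finset.mem_Iio.2 h),
      ← Finset.mul_prod_erase (Finset.Iio k) (fun i => ![1, -1] (x i)) (Finset.mem_Iio.2 h),
      Finset.prod_congr rfl fun i hi => by rw [Function.update_of_ne (Finset.ne_of_mem_erase hi)],
      Function.update_self]
    generalize x j = d
    fin_cases b <;> fin_cases d <;> simp [ha]
  · simp

/-- Jordan–Wigner operators built from off-diagonal matrices anticommute at distinct sites. -/
theorem jordanWigner_anticomm_of_ne {a b : Matrix (Fin 2) (Fin 2) ℂ} (ha : ∀ i, a i i = 0)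
    (hb : ∀ i, b i i = 0) {j k : Fin N} (h : j ≠ k) :
    parityString j * site N a j * (parityString k * site N b k)
      + parityString k * site N b k * (parityString j * site N a j) = 0 := by
  wlog hjk : j < k generalizing a b j k
  · rw [add_comm]
    exact this hb ha h.symm (lt_of_le_of_ne (not_lt.1 hjk) h.symm)
  have h1 : parityString j * site N a j * (parityString k * site N b k)
      = parityString j * (site N a j * parityString k) * site N b k := by noncomm_ring
  have h2 : parityString k * site N b k * (parityString j * site N a j)
      = parityString k * (site N b k * parityString j) * site N a j := by noncomm_ring
  rw [h1, h2, site_mul_parityString_of_lt ha hjk, site_mul_parityString_of_le b hjk.le]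
  simp only [mul_neg, neg_mul, ← mul_assoc]
  rw [parityString_comm k j, mul_assoc _ (site N b k), ← site_mul_site_comm a b h, ← mul_assoc,
    neg_add_cancel]

theorem jordanWigner_anticomm_self (a b : Matrix (Fin 2) (Fin 2) ℂ) (j : Fin N) :
    parityString j * site N a j * (parityString j * site N b j)
      + parityString j * site N b j * (parityString j * site N a j) = site N (a * b + b * a) j := by
  have h (a b : Matrix (Fin 2) (Fin 2) ℂ) :
      parityString j * site N a j * (parityString j * site N b j) = site N (a * b) j := by
    rw [← site_mul_parityString_of_le a le_rfl, mul_assoc, ← mul_assoc (parityString j),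
      parityString_mul_self, one_mul, site_mul_site]
  rw [h, h, site_add]

theorem sigmaPlus_eq : sigmaPlus = !![0, 1; 0, 0] := by
  ext i j
  fin_cases i <;> fin_cases j <;> norm_num [sigmaPlus, sigmaX, sigmaY]

theorem sigmaMinus_eq : sigmaMinus = !![0, 0; 1, 0] := by
  ext i j
  fin_cases i <;> fin_cases j <;> norm_num [sigmaMinus, sigmaX, sigmaY]

theorem sigmaPlus_mul_self : sigmaPlus * sigmaPlus = 0 := by
  ext i j
  fin_cases i <;> fin_cases j <;> simp [sigmaPlus_eq]

theorem sigmaPlus_apply_self (i : Fin 2) : sigmaPlus i i = 0 := by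
  fin_cases i <;> simp [sigmaPlus_eq]

theorem sigmaMinus_mul_self : sigmaMinus * sigmaMinus = 0 := by
  ext i j
  fin_cases i <;> fin_cases j <;> simp [sigmaMinus_eq]

theorem sigmaMinus_apply_self (i : Fin 2) : sigmaMinus i i = 0 := by
  fin_cases i <;> simp [sigmaMinus_eq]

theorem f_eq (j : Fin N) :
    f N j = (I * (-I) ^ (j : ℕ)) • (parityString j * site N sigmaMinus j) := by
  have h : string N ![-I, I] j = (-I) ^ (j : ℕ) • parityString j := by
    simpa using string_smul (-I) j
  rw [f, c, h, smul_mul_assoc, smul_smul, smul_smul, _root_.zpow_neg, zpow_natCast, pow_succ']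
  congr 2
  field_simp

theorem fd_eq (j : Fin N) :
    fd N j = (I * (-I) ^ (j : ℕ)) • (parityString j * site N sigmaPlus j) := by
  rw [fd, cd, string_smul, smul_mul_assoc, smul_smul, smul_smul]
  congr 1
  have : (-I) = I ^ 3 := by rw [I_pow_three]
  rw [this]
  ring

theorem f_anticomm (j k : Fin N) : f N j * f N k + f N k * f N j = 0 := by
  simp only [f_eq, smul_mul_smul_comm]
  rw [mul_comm (I * (-I) ^ (k : ℕ)), ← smul_add]
  rcases eq_or_ne j k with rfl | h
  · rw [jordanWigner_anticomm_self]
    rw [sigmaMinus_mul_self, add_zero, site_zero, smul_zero]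
  · rw [jordanWigner_anticomm_of_ne sigmaMinus_apply_self sigmaMinus_apply_self h, smul_zero]

theorem fd_anticomm (j k : Fin N) : fd N j * fd N k + fd N k * fd N j = 0 := by
  simp only [fd_eq, smul_mul_smul_comm]
  rw [mul_comm (I * (-I) ^ (k : ℕ)), ← smul_add]
  rcases eq_or_ne j k with rfl | h
  · rw [jordanWigner_anticomm_self]
    rw [sigmaPlus_mul_self, add_zero, site_zero, smul_zero]
  · rw [jordanWigner_anticomm_of_ne sigmaPlus_apply_self sigmaPlus_apply_self h, smul_zero]

theorem f_fd_anticomm (j k : Fin N) :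
    f N j * fd N k + fd N k * f N j = if j = k then (-1 : ℤ) ^ ((j : ℕ) + 1) • 1 else 0 := by
  simp only [f_eq, fd_eq, smul_mul_smul_comm]
  rw [mul_comm (I * (-I) ^ (k : ℕ)), ← smul_add]
  split_ifs with h
  · subst h
    have hs : sigmaMinus * sigmaPlus + sigmaPlus * sigmaMinus = 1 := by
      ext i j
      fin_cases i <;> fin_cases j <;> simp [sigmaMinus_eq, sigmaPlus_eq]
    have hI : I * (-I) ^ (j : ℕ) * (I * (-I) ^ (j : ℕ)) = (((-1 : ℤ) ^ ((j : ℕ) + 1) : ℤ) : ℂ) := by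
      rw [mul_mul_mul_comm, ← mul_pow, neg_mul_neg, I_mul_I]
      push_cast
      ring
    rw [jordanWigner_anticomm_self, hs, site_one, hI, Int.cast_smul_eq_zsmul]
  · rw [jordanWigner_anticomm_of_ne sigmaMinus_apply_self sigmaPlus_apply_self h, smul_zero]

end JordanWigner

/-- **The quadratic fermionic operators generate an sl(2):** with
`2h := Σ_j (−1)^j f_j† f_j − L·Id` one has `[F†_(2), F_(2)] = 2h`,
`[2h, F†_(2)] = 2F†_(2)` and `[2h, F_(2)] = −2F_(2)`. -/
theorem gl11_quadratic_sl2 (L : ℕ) (hL : 0 < L) :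
    ∀ twoh : Op (2 * L),
      twoh = (∑ j : Fin (2 * L), ((-1 : ℂ) ^ ((j : ℕ) + 1)) • (fd (2 * L) j * f (2 * L) j))
               - (L : ℂ) • (1 : Op (2 * L)) →
      ⁅Fdg (2 * L) 2, Fg (2 * L) 2⁆ = twoh ∧
      ⁅twoh, Fdg (2 * L) 2⁆ = (2 : ℂ) • Fdg (2 * L) 2 ∧
      ⁅twoh, Fg (2 * L) 2⁆ = (-2 : ℂ) • Fg (2 * L) 2 := by
  rintro _ rfl
  have hF : Fg (2 * L) 2 = pairSum (f (2 * L)) := sum_powersetCard_two_sort _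
  have hFd : Fdg (2 * L) 2 = pairSum (fd (2 * L)) := sum_powersetCard_two_sort _
  have hn : (∑ j : Fin (2 * L), ((-1 : ℂ) ^ ((j : ℕ) + 1)) • (fd (2 * L) j * f (2 * L) j))
      = alternatingNumber (f (2 * L)) (fd (2 * L)) := by
    refine Finset.sum_congr rfl fun j _ => ?_
    rw [← Int.cast_smul_eq_zsmul ℂ]
    push_cast
    rfl
  have hL1 : (L : ℂ) • (1 : Op (2 * L)) = (L : Op (2 * L)) := by
    rw [Nat.cast_smul_eq_nsmul, nsmul_one]
  have hlie (x y : Op (2 * L)) : ⁅x - (L : Op (2 * L)), y⁆ = ⁅x, y⁆ := by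
    rw [Ring.lie_def, Ring.lie_def, sub_mul, mul_sub, (Nat.cast_commute L y).eq]
    abel
  rw [hF, hFd, hn, hL1, hlie, hlie]
  refine ⟨lie_pairSum_pairSum f_fd_anticomm, ?_, ?_⟩
  · rw [lie_pairSum_of_lie_eq_smul 1, ← Int.cast_smul_eq_zsmul ℂ]
    · norm_num
    · intro i
      rw [lie_alternatingNumber_creation fd_anticomm f_fd_anticomm, one_smul]
  · rw [lie_pairSum_of_lie_eq_smul (-1), ← Int.cast_smul_eq_zsmul ℂ]
    · norm_num
    · intro i
      rw [lie_alternatingNumber_annihilation f_anticomm f_fd_anticomm, neg_one_smul]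

end SpinChain

end
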